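/- (Theorem 6) Let ρ_i be a tripartite density matrix on nA × nB × nR, and let Λ^R be an incoherent quantum channel on R, given in Kraus form by matrices M j : Matrix nR nR ℂ with ∑ j, (M j)∗ · (M j) = 1 and such that for every diagonal matrix d : Matrix nR nR ℂ, (M j) · d · (M j)∗ is diagonal. Let ρ_f = ∑ j, (1 ⊗ 1 ⊗ M j) ρ_i (1 ⊗ 1 ⊗ M j)∗ be the state after sending R through the channel. Then C^{AR|B}(ρ_f) − C^{A|BR}(ρ_i) ≤ C^{R|AB}(ρ_f). -/

import Mathlib

open Matrix
open Kronecker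
open scoped ComplexOrder

/-- Von Neumann entropy of a matrix (defined via its eigenvalues when it is Hermitian). -/
noncomputable def vN {n : Type*} [Fintype n] [DecidableEq n] (ρ : Matrix n n ℂ) : ℝ :=
  letI := Classical.propDecidable ρ.IsHermitian
  if h : ρ.IsHermitian then ∑ i, Real.negMulLog (h.eigenvalues i) else 0

/-- Partial dephasing on the `A` subsystem of a tripartite state on `nA × nB × nR`. -/
noncomputable def dephA3 {nA nB nR : Type*}
    [Fintype nA] [DecidableEq nA] [Fintype nB] [DecidableEq nB] [Fintype nR] [DecidableEq nR]
    (ρ : Matrix (nA × nB × nR) (nA × nB × nR) ℂ) : Matrix (nA × nB × nR) (nA × nB × nR) ℂ :=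
  Matrix.of fun p q => if p.1 = q.1 then ρ p q else 0

/-- Partial dephasing on the `R` subsystem of a tripartite state on `nA × nB × nR`. -/
noncomputable def dephR3 {nA nB nR : Type*}
    [Fintype nA] [DecidableEq nA] [Fintype nB] [DecidableEq nB] [Fintype nR] [DecidableEq nR]
    (ρ : Matrix (nA × nB × nR) (nA × nB × nR) ℂ) : Matrix (nA × nB × nR) (nA × nB × nR) ℂ :=
  Matrix.of fun p q => if p.2.2 = q.2.2 then ρ p q else 0

/-- Partial dephasing on the `A` and `R` subsystems of a tripartite state on `nA × nB × nR`. -/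
noncomputable def dephAR3 {nA nB nR : Type*}
    [Fintype nA] [DecidableEq nA] [Fintype nB] [DecidableEq nB] [Fintype nR] [DecidableEq nR]
    (ρ : Matrix (nA × nB × nR) (nA × nB × nR) ℂ) : Matrix (nA × nB × nR) (nA × nB × nR) ℂ :=
  Matrix.of fun p q => if p.1 = q.1 ∧ p.2.2 = q.2.2 then ρ p q else 0

section RelativeEntropy

variable {n m κ ι : Type*}

/-- The projection onto the basis vectors with label `k`. -/
def labelProj [DecidableEq n] [DecidableEq κ] (f : n → κ) (k : κ) : Matrix n n ℂ :=
  diagonal fun p => if f p = k then 1 else 0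

lemma conjTranspose_labelProj [DecidableEq n] [DecidableEq κ] (f : n → κ) (k : κ) :
    (labelProj f k)ᴴ = labelProj f k := by
  rw [labelProj, Matrix.diagonal_conjTranspose]
  congr 1
  ext p
  rw [Pi.star_apply]
  split_ifs <;> simp

variable [Fintype n] [Fintype ι]

/-- The map `ρ ↦ ∑ j, K j * ρ * (K j)ᴴ`. -/
def krausMap (K : ι → Matrix m n ℂ) (ρ : Matrix n n ℂ) : Matrix m m ℂ :=
  ∑ j, K j * ρ * (K j)ᴴ

lemma conjTranspose_krausMap (K : ι → Matrix m n ℂ) (ρ : Matrix n n ℂ) :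
    (krausMap K ρ)ᴴ = krausMap K ρᴴ := by
  simp [krausMap, Matrix.conjTranspose_sum, Matrix.mul_assoc]

variable [Fintype m]

lemma krausMap_posSemidef (K : ι → Matrix m n ℂ) {ρ : Matrix n n ℂ} (hρ : ρ.PosSemidef) :
    (krausMap K ρ).PosSemidef :=
  Matrix.posSemidef_sum _ fun j _ => hρ.mul_mul_conjTranspose_same (K j)

lemma trace_krausMap_mul (K : ι → Matrix m n ℂ) (ρ : Matrix n n ℂ) (Y : Matrix m m ℂ) :
    (krausMap K ρ * Y).trace = (ρ * krausMap (fun j => (K j)ᴴ) Y).trace := by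
  simp only [krausMap, Matrix.sum_mul, Matrix.mul_sum, Matrix.trace_sum,
    Matrix.conjTranspose_conjTranspose]
  refine Finset.sum_congr rfl fun j _ => ?_
  rw [Matrix.mul_assoc, Matrix.mul_assoc, Matrix.trace_mul_comm]
  simp only [Matrix.mul_assoc]

variable [DecidableEq n]

lemma vN_of_isHermitian {ρ : Matrix n n ℂ} (h : ρ.IsHermitian) :
    vN ρ = ∑ i, Real.negMulLog (h.eigenvalues i) := by
  unfold vN
  rw [dif_pos h]

/-- The squared modulus of the inner product of the `j`-th eigenvector of `σ` with the `i`-th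
eigenvector of `ρ`. -/
noncomputable def overlap {ρ σ : Matrix n n ℂ} (hρ : ρ.IsHermitian) (hσ : σ.IsHermitian)
    (j i : n) : ℝ :=
  Complex.normSq (((hσ.eigenvectorUnitary : Matrix n n ℂ)ᴴ * hρ.eigenvectorUnitary) j i)

lemma overlap_nonneg {ρ σ : Matrix n n ℂ} (hρ : ρ.IsHermitian) (hσ : σ.IsHermitian)
    (j i : n) : 0 ≤ overlap hρ hσ j i :=
  Complex.normSq_nonneg _

lemma Matrix.IsHermitian.eq_conj_diagonal {ρ : Matrix n n ℂ} (hρ : ρ.IsHermitian) :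
    ρ = (hρ.eigenvectorUnitary : Matrix n n ℂ) * diagonal (fun i => (hρ.eigenvalues i : ℂ)) *
      (hρ.eigenvectorUnitary : Matrix n n ℂ)ᴴ := by
  conv_lhs => rw [hρ.spectral_theorem, Unitary.conjStarAlgAut_apply]
  rfl

lemma Matrix.IsHermitian.conjTranspose_mul_eigenvectorUnitary {ρ : Matrix n n ℂ}
    (hρ : ρ.IsHermitian) :
    (hρ.eigenvectorUnitary : Matrix n n ℂ)ᴴ * hρ.eigenvectorUnitary = 1 :=
  Unitary.coe_star_mul_self hρ.eigenvectorUnitary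

lemma Matrix.IsHermitian.eigenvectorUnitary_mul_conjTranspose {ρ : Matrix n n ℂ}
    (hρ : ρ.IsHermitian) :
    (hρ.eigenvectorUnitary : Matrix n n ℂ) * (hρ.eigenvectorUnitary : Matrix n n ℂ)ᴴ = 1 :=
  Unitary.coe_mul_star_self hρ.eigenvectorUnitary

lemma trace_diagonal_mul_conjTranspose_mul_diagonal_mul (W : Matrix n n ℂ) (p g : n → ℝ) :
    (diagonal (fun i => (p i : ℂ)) * Wᴴ * diagonal (fun j => (g j : ℂ)) * W).trace.re =
      ∑ j, ∑ i, Complex.normSq (W j i) * p i * g j := by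
  simp only [Matrix.trace, Matrix.diag_apply, Matrix.mul_apply (M := _ * _ * _),
    Matrix.mul_diagonal, Matrix.diagonal_mul, Matrix.conjTranspose_apply, Complex.re_sum]
  rw [Finset.sum_comm]
  refine Finset.sum_congr rfl fun j _ => Finset.sum_congr rfl fun i _ => ?_
  simp only [Complex.normSq_apply, Complex.mul_re, Complex.mul_im, Complex.ofReal_re,
    Complex.ofReal_im, Complex.star_def, Complex.conj_re, Complex.conj_im]
  ring

/-- The matrix `g(σ)` obtained by applying `g` to the eigenvalues of `σ`. -/
noncomputable def eigenMap {σ : Matrix n n ℂ} (hσ : σ.IsHermitian) (g : ℝ → ℝ) : Matrix n n ℂ :=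
  (hσ.eigenvectorUnitary : Matrix n n ℂ) * diagonal (fun i => (g (hσ.eigenvalues i) : ℂ)) *
      (hσ.eigenvectorUnitary : Matrix n n ℂ)ᴴ

lemma trace_mul_eigenMap {ρ σ : Matrix n n ℂ} (hρ : ρ.IsHermitian) (hσ : σ.IsHermitian)
    (g : ℝ → ℝ) :
    (ρ * eigenMap hσ g).trace.re =
      ∑ j, ∑ i, overlap hρ hσ j i * hρ.eigenvalues i * g (hσ.eigenvalues j) := by
  unfold overlap
  rw [← trace_diagonal_mul_conjTranspose_mul_diagonal_mul]
  conv_lhs => rw [hρ.eq_conj_diagonal, eigenMap, Matrix.mul_assoc, Matrix.mul_assoc,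
    Matrix.trace_mul_comm]
  simp only [Matrix.conjTranspose_mul, Matrix.conjTranspose_conjTranspose, Matrix.mul_assoc]

lemma trace_mul_eigenMap_self {σ : Matrix n n ℂ} (hσ : σ.IsHermitian) (g : ℝ → ℝ) :
    (σ * eigenMap hσ g).trace.re = ∑ j, hσ.eigenvalues j * g (hσ.eigenvalues j) := by
  rw [trace_mul_eigenMap hσ hσ]
  refine Finset.sum_congr rfl fun j _ => ?_
  rw [Finset.sum_eq_single j]
  · simp [overlap, hσ.conjTranspose_mul_eigenvectorUnitary]
  · intro i _ hi
    simp [overlap, hσ.conjTranspose_mul_eigenvectorUnitary, Matrix.one_apply_ne hi.symm]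
  · simp

lemma sum_overlap {ρ σ : Matrix n n ℂ} (hρ : ρ.IsHermitian) (hσ : σ.IsHermitian) (i : n) :
    ∑ j, overlap hρ hσ j i = 1 := by
  have h : (((hσ.eigenvectorUnitary : Matrix n n ℂ)ᴴ *
      (hρ.eigenvectorUnitary : Matrix n n ℂ))ᴴ *
      ((hσ.eigenvectorUnitary : Matrix n n ℂ)ᴴ *
      (hρ.eigenvectorUnitary : Matrix n n ℂ))) i i = 1 := by
    rw [Matrix.conjTranspose_mul, Matrix.conjTranspose_conjTranspose, Matrix.mul_assoc,
      ← Matrix.mul_assoc (hσ.eigenvectorUnitary : Matrix n n ℂ),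
      hσ.eigenvectorUnitary_mul_conjTranspose, Matrix.one_mul,
      hρ.conjTranspose_mul_eigenvectorUnitary, Matrix.one_apply_eq]
  rw [Matrix.mul_apply] at h
  have h' := congrArg Complex.re h
  rw [Complex.re_sum, Complex.one_re] at h'
  rw [← h']
  refine Finset.sum_congr rfl fun j _ => ?_
  simp only [overlap, Matrix.conjTranspose_apply, Complex.normSq_apply, Complex.mul_re,
    Complex.star_def, Complex.conj_re, Complex.conj_im]
  ring

lemma commute_eigenMap {σ D : Matrix n n ℂ} (hσ : σ.IsHermitian) (g : ℝ → ℝ)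
    (h : Commute σ D) : Commute (eigenMap hσ g) D := by
  have hV := hσ.conjTranspose_mul_eigenvectorUnitary
  have hV' := hσ.eigenvectorUnitary_mul_conjTranspose
  have hs := hσ.eq_conj_diagonal
  unfold eigenMap
  set V : Matrix n n ℂ := (hσ.eigenvectorUnitary : Matrix n n ℂ)
  have key : ∀ d : n → ℂ, V * diagonal d * Vᴴ * D = V * (diagonal d * (Vᴴ * D * V)) * Vᴴ := by
    intro d
    simp only [Matrix.mul_assoc, hV', Matrix.mul_one]
  have key' : ∀ d : n → ℂ, D * (V * diagonal d * Vᴴ) = V * ((Vᴴ * D * V) * diagonal d) * Vᴴ := by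
    intro d
    simp only [← Matrix.mul_assoc, hV', Matrix.one_mul]
  have h0 : diagonal (fun i => (hσ.eigenvalues i : ℂ)) * (Vᴴ * D * V) =
      (Vᴴ * D * V) * diagonal (fun i => (hσ.eigenvalues i : ℂ)) := by
    have h1 := h.eq
    rw [hs, key, key'] at h1
    have h2 := congrArg (fun Z => Vᴴ * Z * V) h1
    simpa only [Matrix.mul_assoc, hV, Matrix.mul_one, ← Matrix.mul_assoc Vᴴ V,
      Matrix.one_mul] using h2
  rw [commute_iff_eq, key, key']
  congr 2
  ext i j
  have hij := congrFun (congrFun h0 i) j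
  rw [Matrix.diagonal_mul, Matrix.mul_diagonal] at hij ⊢
  by_cases hz : hσ.eigenvalues i = hσ.eigenvalues j
  · rw [hz, mul_comm]
  · have : ((hσ.eigenvalues i : ℂ) - hσ.eigenvalues j) * (Vᴴ * D * V) i j = 0 := by
      linear_combination hij
    rcases mul_eq_zero.mp this with h3 | h3
    · exact absurd (by exact_mod_cast sub_eq_zero.mp h3) hz
    · rw [h3]; simp

/-! ### A variational functional that is monotone under quantum channels -/

/-- The concave functional of `X` whose supremum over `X` is
`Tr (ρ ((1 - s) R_ρ + s L_σ)⁻¹ ρ)`. -/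
noncomputable def variational (s : ℝ) (ρ σ X : Matrix n n ℂ) : ℝ :=
  2 * (Xᴴ * ρ).trace.re - s * (Xᴴ * σ * X).trace.re - (1 - s) * (X * ρ * Xᴴ).trace.re

/-- The supremum of `variational s ρ σ`, written in eigenvectors. -/
noncomputable def variationalSup {ρ σ : Matrix n n ℂ} (s : ℝ) (hρ : ρ.IsHermitian)
    (hσ : σ.IsHermitian) : ℝ :=
  ∑ j, ∑ i, overlap hρ hσ j i *
    (hρ.eigenvalues i ^ 2 / ((1 - s) * hρ.eigenvalues i + s * hσ.eigenvalues j))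

lemma variational_eq_sum {ρ σ : Matrix n n ℂ} (hρ : ρ.IsHermitian) (hσ : σ.IsHermitian)
    (s : ℝ) (Y : Matrix n n ℂ) :
    variational s ρ σ ((hσ.eigenvectorUnitary : Matrix n n ℂ) * Y *
      (hρ.eigenvectorUnitary : Matrix n n ℂ)ᴴ) =
    ∑ j, ∑ i, (2 * (star (Y j i) * ((hσ.eigenvectorUnitary : Matrix n n ℂ)ᴴ *
        hρ.eigenvectorUnitary) j i).re * hρ.eigenvalues i -
      Complex.normSq (Y j i) *
        ((1 - s) * hρ.eigenvalues i + s * hσ.eigenvalues j)) := by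
  have hU := hρ.conjTranspose_mul_eigenvectorUnitary
  have hV := hσ.conjTranspose_mul_eigenvectorUnitary
  have hr := hρ.eq_conj_diagonal
  have hs := hσ.eq_conj_diagonal
  set U : Matrix n n ℂ := (hρ.eigenvectorUnitary : Matrix n n ℂ)
  set V : Matrix n n ℂ := (hσ.eigenvectorUnitary : Matrix n n ℂ)
  set p := hρ.eigenvalues
  set q := hσ.eigenvalues
  have t1 : ((V * Y * Uᴴ)ᴴ * ρ).trace.re =
      ∑ j, ∑ i, (star (Y j i) * (Vᴴ * U) j i).re * p i := by
    have : ((V * Y * Uᴴ)ᴴ * ρ).trace =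
        (Yᴴ * ((Vᴴ * U) * diagonal (fun i => (p i : ℂ)))).trace := by
      rw [hr]
      simp only [Matrix.conjTranspose_mul, Matrix.conjTranspose_conjTranspose, Matrix.mul_assoc]
      rw [Matrix.trace_mul_comm]
      simp only [Matrix.mul_assoc, hU, Matrix.mul_one]
    rw [this]
    simp only [Matrix.trace, Matrix.diag_apply, Matrix.mul_apply (M := Yᴴ),
      Matrix.mul_diagonal, Matrix.conjTranspose_apply, Complex.re_sum]
    rw [Finset.sum_comm]
    refine Finset.sum_congr rfl fun j _ => Finset.sum_congr rfl fun i _ => ?_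
    rw [← mul_assoc, Complex.re_mul_ofReal]
  have t2 : ((V * Y * Uᴴ)ᴴ * σ * (V * Y * Uᴴ)).trace.re =
      ∑ j, ∑ i, Complex.normSq (Y j i) * q j := by
    have : ((V * Y * Uᴴ)ᴴ * σ * (V * Y * Uᴴ)).trace =
        (diagonal (fun _ : n => ((1 : ℝ) : ℂ)) * Yᴴ * diagonal (fun i => (q i : ℂ)) * Y).trace := by
      rw [hs]
      simp only [Matrix.conjTranspose_mul, Matrix.conjTranspose_conjTranspose, Matrix.mul_assoc]
      rw [Matrix.trace_mul_comm]
      simp only [Matrix.mul_assoc, hU, Matrix.mul_one, ← Matrix.mul_assoc Vᴴ V, hV,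
        Matrix.one_mul, Complex.ofReal_one, Matrix.diagonal_one]
    rw [this, trace_diagonal_mul_conjTranspose_mul_diagonal_mul]
    simp
  have t3 : ((V * Y * Uᴴ) * ρ * (V * Y * Uᴴ)ᴴ).trace.re =
      ∑ j, ∑ i, Complex.normSq (Y j i) * p i := by
    have : ((V * Y * Uᴴ) * ρ * (V * Y * Uᴴ)ᴴ).trace =
        (diagonal (fun i => (p i : ℂ)) * Yᴴ * diagonal (fun _ : n => ((1 : ℝ) : ℂ)) * Y).trace := by
      rw [hr]
      simp only [Matrix.conjTranspose_mul, Matrix.conjTranspose_conjTranspose, Matrix.mul_assoc,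
        ← Matrix.mul_assoc Uᴴ U, hU, Matrix.one_mul]
      rw [Matrix.trace_mul_comm]
      simp only [Matrix.mul_assoc, hV, Matrix.mul_one]
      rw [Matrix.trace_mul_comm]
      simp only [Matrix.mul_assoc, Complex.ofReal_one, Matrix.diagonal_one, Matrix.one_mul]
    rw [this, trace_diagonal_mul_conjTranspose_mul_diagonal_mul]
    simp
  rw [variational, t1, t2, t3]
  simp only [Finset.mul_sum, ← Finset.sum_sub_distrib]
  refine Finset.sum_congr rfl fun j _ => Finset.sum_congr rfl fun i _ => ?_
  ring

lemma two_mul_re_mul_sub_normSq_mul_le {p c : ℝ} (hc : 0 < c) (y w : ℂ) :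
    2 * (star y * w).re * p - Complex.normSq y * c ≤ Complex.normSq w * (p ^ 2 / c) := by
  have e : Complex.normSq w * (p ^ 2 / c) - (2 * (star y * w).re * p - Complex.normSq y * c) =
      Complex.normSq (w * p - y * c) / c := by
    simp only [Complex.normSq_apply, Complex.sub_re, Complex.sub_im, Complex.mul_re,
      Complex.mul_im, Complex.ofReal_re, Complex.ofReal_im, Complex.star_def, Complex.conj_re,
      Complex.conj_im]
    field_simp
    ring
  have := div_nonneg (Complex.normSq_nonneg (w * p - y * c)) hc.le
  linarith

lemma variational_le {ρ σ : Matrix n n ℂ} (hρ : ρ.PosSemidef) (hσ : σ.PosSemidef)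
    {s : ℝ} (hs0 : 0 < s) (hs1 : s < 1) (X : Matrix n n ℂ) :
    variational s ρ σ X ≤ variationalSup s hρ.isHermitian hσ.isHermitian := by
  have hX : X = (hσ.isHermitian.eigenvectorUnitary : Matrix n n ℂ) *
      ((hσ.isHermitian.eigenvectorUnitary : Matrix n n ℂ)ᴴ * X *
        hρ.isHermitian.eigenvectorUnitary) *
      (hρ.isHermitian.eigenvectorUnitary : Matrix n n ℂ)ᴴ := by
    simp only [Matrix.mul_assoc, hρ.isHermitian.eigenvectorUnitary_mul_conjTranspose,
      Matrix.mul_one]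
    rw [← Matrix.mul_assoc, hσ.isHermitian.eigenvectorUnitary_mul_conjTranspose, Matrix.one_mul]
  rw [hX, variational_eq_sum, variationalSup]
  refine Finset.sum_le_sum fun j _ => Finset.sum_le_sum fun i _ => ?_
  have hp := hρ.eigenvalues_nonneg i
  have hq := hσ.eigenvalues_nonneg j
  rcases hp.eq_or_lt with hp | hp
  · rw [← hp]
    have : 0 ≤ s * hσ.isHermitian.eigenvalues j := by positivity
    simp only [mul_zero, zero_add, zero_sub, ne_eq, OfNat.ofNat_ne_zero, not_false_eq_true,
      zero_pow, zero_div]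
    exact neg_nonpos.mpr (mul_nonneg (Complex.normSq_nonneg _) this)
  · have : 0 < 1 - s := by linarith
    exact two_mul_re_mul_sub_normSq_mul_le (by positivity) _ _

lemma exists_variational_eq {ρ σ : Matrix n n ℂ} (hρ : ρ.PosSemidef) (hσ : σ.PosSemidef)
    {s : ℝ} (hs0 : 0 < s) (hs1 : s < 1) :
    ∃ X, variational s ρ σ X = variationalSup s hρ.isHermitian hσ.isHermitian := by
  refine ⟨_, (variational_eq_sum hρ.isHermitian hσ.isHermitian s (Matrix.of fun j i =>
    ((hσ.isHermitian.eigenvectorUnitary : Matrix n n ℂ)ᴴ *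
      hρ.isHermitian.eigenvectorUnitary) j i * ((hρ.isHermitian.eigenvalues i /
      ((1 - s) * hρ.isHermitian.eigenvalues i + s * hσ.isHermitian.eigenvalues j) : ℝ) : ℂ))).trans
    ?_⟩
  refine Finset.sum_congr rfl fun j _ => Finset.sum_congr rfl fun i _ => ?_
  have hp := hρ.eigenvalues_nonneg i
  have hq := hσ.eigenvalues_nonneg j
  unfold overlap
  set W := (hσ.isHermitian.eigenvectorUnitary : Matrix n n ℂ)ᴴ *
      hρ.isHermitian.eigenvectorUnitary
  simp only [Matrix.of_apply]
  generalize hρ.isHermitian.eigenvalues i = p at hp ⊢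
  generalize hσ.isHermitian.eigenvalues j = q at hq ⊢
  rcases hp.eq_or_lt with hp | hp
  · simp [← hp]
  · have : 0 < 1 - s := by linarith
    have hc : 0 < (1 - s) * p + s * q := by positivity
    generalize (1 - s) * p + s * q = c at hc ⊢
    simp only [Complex.normSq_apply, Complex.mul_re,
      Complex.mul_im, Complex.ofReal_re, Complex.ofReal_im, Complex.star_def, Complex.conj_re,
      Complex.conj_im]
    field_simp
    ring

/-! ### Monotonicity under channels in Kraus form -/

lemma trace_krausMap {K : ι → Matrix m n ℂ} (hK : ∑ j, (K j)ᴴ * K j = 1) (ρ : Matrix n n ℂ) :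
    (krausMap K ρ).trace = ρ.trace := by
  classical
  have := trace_krausMap_mul K ρ 1
  simpa [krausMap, hK] using this

/-- The Kadison–Schwarz inequality for the dual channel, traced against a positive matrix. -/
lemma trace_conj_dual_krausMap_le {K : ι → Matrix m n ℂ} (hK : ∑ j, (K j)ᴴ * K j = 1)
    {ρ : Matrix n n ℂ} (hρ : ρ.PosSemidef) (Y : Matrix m m ℂ) :
    (krausMap (fun j => (K j)ᴴ) Y * ρ * (krausMap (fun j => (K j)ᴴ) Y)ᴴ).trace.re ≤
      (Y * krausMap K ρ * Yᴴ).trace.re := by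
  set X := krausMap (fun j => (K j)ᴴ) Y with hX
  have hX1 : ∑ j, (K j)ᴴ * Y * K j = X := by simp [hX, krausMap]
  have hX2 : ∑ j, (K j)ᴴ * Yᴴ * K j = Xᴴ := by
    rw [hX, conjTranspose_krausMap]; simp [krausMap]
  have hnn : 0 ≤ (∑ j, (Y * K j - K j * X) * ρ * (Y * K j - K j * X)ᴴ).trace.re :=
    (Complex.le_def.mp (Matrix.posSemidef_sum _ fun j _ =>
      hρ.mul_mul_conjTranspose_same (Y * K j - K j * X)).trace_nonneg).1
  have e : (∑ j, (Y * K j - K j * X) * ρ * (Y * K j - K j * X)ᴴ).trace =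
      (Y * krausMap K ρ * Yᴴ).trace - (X * ρ * Xᴴ).trace := by
    have a1 : ∑ j, (Y * K j * ρ * (K j)ᴴ * Yᴴ).trace = (Y * krausMap K ρ * Yᴴ).trace := by
      simp only [krausMap, Matrix.mul_sum, Matrix.sum_mul, Matrix.trace_sum, Matrix.mul_assoc]
    have a2 : ∑ j, (Y * K j * ρ * Xᴴ * (K j)ᴴ).trace = (X * ρ * Xᴴ).trace := by
      rw [Matrix.mul_assoc X]
      nth_rewrite 2 [← hX1]
      simp only [Matrix.sum_mul, Matrix.trace_sum]
      refine Finset.sum_congr rfl fun j _ => ?_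
      rw [Matrix.trace_mul_comm]
      simp only [Matrix.mul_assoc]
    have a3 : ∑ j, (K j * X * ρ * (K j)ᴴ * Yᴴ).trace = (X * ρ * Xᴴ).trace := by
      conv_rhs => rw [← hX2]
      simp only [Matrix.mul_sum, Matrix.trace_sum]
      refine Finset.sum_congr rfl fun j _ => ?_
      rw [Matrix.mul_assoc, Matrix.mul_assoc, Matrix.mul_assoc, Matrix.trace_mul_comm]
      simp only [Matrix.mul_assoc]
    have a4 : ∑ j, (K j * X * ρ * Xᴴ * (K j)ᴴ).trace = (X * ρ * Xᴴ).trace := by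
      have : X * ρ * Xᴴ = ∑ j, (K j)ᴴ * K j * (X * ρ * Xᴴ) := by
        rw [← Matrix.sum_mul, hK, Matrix.one_mul]
      conv_rhs => rw [this]
      rw [Matrix.trace_sum]
      refine Finset.sum_congr rfl fun j _ => ?_
      rw [Matrix.trace_mul_comm]
      simp only [Matrix.mul_assoc]
    have : ∀ j, ((Y * K j - K j * X) * ρ * (Y * K j - K j * X)ᴴ).trace =
        (Y * K j * ρ * (K j)ᴴ * Yᴴ).trace - (Y * K j * ρ * Xᴴ * (K j)ᴴ).trace -
        (K j * X * ρ * (K j)ᴴ * Yᴴ).trace + (K j * X * ρ * Xᴴ * (K j)ᴴ).trace := by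
      intro j
      simp only [Matrix.conjTranspose_sub, Matrix.conjTranspose_mul, Matrix.sub_mul,
        Matrix.mul_sub, Matrix.trace_sub, Matrix.mul_assoc]
      ring
    rw [Matrix.trace_sum, Finset.sum_congr rfl fun j _ => this j, Finset.sum_add_distrib,
      Finset.sum_sub_distrib, Finset.sum_sub_distrib, a1, a2, a3, a4]
    ring
  rw [e, Complex.sub_re] at hnn
  linarith

lemma variational_krausMap_le {K : ι → Matrix m n ℂ} (hK : ∑ j, (K j)ᴴ * K j = 1)
    {ρ σ : Matrix n n ℂ} (hρ : ρ.PosSemidef) (hσ : σ.PosSemidef)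
    {s : ℝ} (hs0 : 0 < s) (hs1 : s < 1) (Y : Matrix m m ℂ) :
    variational s (krausMap K ρ) (krausMap K σ) Y ≤
      variational s ρ σ (krausMap (fun j => (K j)ᴴ) Y) := by
  have h1 := trace_conj_dual_krausMap_le hK hρ Y
  have h2 := trace_conj_dual_krausMap_le hK hσ Yᴴ
  rw [← conjTranspose_krausMap, Matrix.conjTranspose_conjTranspose,
    Matrix.conjTranspose_conjTranspose] at h2
  have h3 : (Yᴴ * krausMap K ρ).trace = ((krausMap (fun j => (K j)ᴴ) Y)ᴴ * ρ).trace := by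
    rw [Matrix.trace_mul_comm, trace_krausMap_mul, Matrix.trace_mul_comm, conjTranspose_krausMap]
  unfold variational
  rw [h3]
  have := mul_le_mul_of_nonneg_left h1 (sub_nonneg.mpr hs1.le)
  have := mul_le_mul_of_nonneg_left h2 hs0.le
  linarith

variable [DecidableEq m]

lemma variationalSup_krausMap_le {K : ι → Matrix m n ℂ} (hK : ∑ j, (K j)ᴴ * K j = 1)
    {ρ σ : Matrix n n ℂ} (hρ : ρ.PosSemidef) (hσ : σ.PosSemidef)
    {s : ℝ} (hs0 : 0 < s) (hs1 : s < 1) :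
    variationalSup s (krausMap_posSemidef K hρ).isHermitian
      (krausMap_posSemidef K hσ).isHermitian ≤
      variationalSup s hρ.isHermitian hσ.isHermitian := by
  obtain ⟨Y, hY⟩ := exists_variational_eq (krausMap_posSemidef K hρ)
    (krausMap_posSemidef K hσ) hs0 hs1
  rw [← hY]
  exact (variational_krausMap_le hK hρ hσ hs0 hs1 Y).trans (variational_le hρ hσ hs0 hs1 _)

/-! ### Relative entropy -/

/-- The quantum relative entropy `D(ρ‖σ)`, meaningful when the support of `ρ` is contained in that
of `σ`. -/
noncomputable def relEntropy {ρ σ : Matrix n n ℂ} (hρ : ρ.IsHermitian) (hσ : σ.IsHermitian) : ℝ :=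
  ∑ j, ∑ i, overlap hρ hσ j i * (hρ.eigenvalues i * Real.log (hρ.eigenvalues i) -
    hρ.eigenvalues i * Real.log (hσ.eigenvalues j))

/-- Eigenvectors of `ρ` with nonzero eigenvalue are orthogonal to the kernel of `σ`. -/
def SupportedIn {ρ σ : Matrix n n ℂ} (hρ : ρ.IsHermitian) (hσ : σ.IsHermitian) : Prop :=
  ∀ j i, hσ.eigenvalues j = 0 → overlap hρ hσ j i * hρ.eigenvalues i = 0

/-- The integrand on `[0, 1]` obtained by writing the logarithms in the relative entropy as
integrals. -/
noncomputable def relEntropyIntegrand {ρ σ : Matrix n n ℂ} (hρ : ρ.IsHermitian)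
    (hσ : σ.IsHermitian) (s : ℝ) : ℝ :=
  ∑ j, ∑ i, overlap hρ hσ j i * (hρ.eigenvalues i * (hρ.eigenvalues i - hσ.eigenvalues j) /
    ((1 - s) * hρ.eigenvalues i + s * hσ.eigenvalues j))

lemma intervalIntegrable_div_lineMap {p q : ℝ} (hp : 0 < p) (hq : 0 < q) :
    IntervalIntegrable (fun s : ℝ => p * (p - q) / ((1 - s) * p + s * q))
      MeasureTheory.volume 0 1 := by
  refine ContinuousOn.intervalIntegrable ?_
  rw [Set.uIcc_of_le zero_le_one]
  refine ContinuousOn.div (by fun_prop) (by fun_prop) fun s hs => ?_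
  nlinarith [hs.1, hs.2, mul_nonneg hs.1 hq.le, mul_nonneg (sub_nonneg.mpr hs.2) hp.le]

lemma integral_div_lineMap {p q : ℝ} (hp : 0 < p) (hq : 0 < q) :
    ∫ s in (0 : ℝ)..1, p * (p - q) / ((1 - s) * p + s * q) =
      p * Real.log p - p * Real.log q := by
  rw [intervalIntegral.integral_eq_sub_of_hasDerivAt
    (f := fun s => -(p * Real.log ((1 - s) * p + s * q)))
    _ (intervalIntegrable_div_lineMap hp hq)]
  · simp
    ring
  · intro s hs
    rw [Set.uIcc_of_le zero_le_one] at hs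
    have hne : (1 - s) * p + s * q ≠ 0 := by
      nlinarith [hs.1, hs.2, mul_nonneg hs.1 hq.le, mul_nonneg (sub_nonneg.mpr hs.2) hp.le]
    have h1 : HasDerivAt (fun s : ℝ => (1 - s) * p + s * q) (-1 * p + 1 * q) s :=
      (((hasDerivAt_id s).const_sub 1).mul_const p).add ((hasDerivAt_id s).mul_const q)
    refine ((h1.log hne).const_mul p).neg.congr_deriv ?_
    ring

lemma intervalIntegrable_and_integral_eq_relEntropy {ρ σ : Matrix n n ℂ} (hρ : ρ.PosSemidef)
    (hσ : σ.PosSemidef) (h : SupportedIn hρ.isHermitian hσ.isHermitian) :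
    IntervalIntegrable (relEntropyIntegrand hρ.isHermitian hσ.isHermitian)
      MeasureTheory.volume 0 1 ∧
    ∫ s in (0 : ℝ)..1, relEntropyIntegrand hρ.isHermitian hσ.isHermitian s =
      relEntropy hρ.isHermitian hσ.isHermitian := by
  have key : ∀ j i, IntervalIntegrable (fun s : ℝ => overlap hρ.isHermitian hσ.isHermitian j i *
      (hρ.isHermitian.eigenvalues i *
        (hρ.isHermitian.eigenvalues i - hσ.isHermitian.eigenvalues j) /
        ((1 - s) * hρ.isHermitian.eigenvalues i + s * hσ.isHermitian.eigenvalues j)))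
      MeasureTheory.volume 0 1 ∧
      ∫ s in (0 : ℝ)..1, overlap hρ.isHermitian hσ.isHermitian j i *
      (hρ.isHermitian.eigenvalues i *
        (hρ.isHermitian.eigenvalues i - hσ.isHermitian.eigenvalues j) /
        ((1 - s) * hρ.isHermitian.eigenvalues i + s * hσ.isHermitian.eigenvalues j)) =
      overlap hρ.isHermitian hσ.isHermitian j i *
        (hρ.isHermitian.eigenvalues i * Real.log (hρ.isHermitian.eigenvalues i) -
        hρ.isHermitian.eigenvalues i * Real.log (hσ.isHermitian.eigenvalues j)) := by
    intro j i
    by_cases hz : overlap hρ.isHermitian hσ.isHermitian j i * hρ.isHermitian.eigenvalues i = 0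
    · rcases mul_eq_zero.mp hz with h0 | h0 <;> simp [h0]
    · have hq : 0 < hσ.isHermitian.eigenvalues j :=
        lt_of_le_of_ne (hσ.eigenvalues_nonneg j) fun hq => hz (h j i hq.symm)
      have hp : 0 < hρ.isHermitian.eigenvalues i :=
        lt_of_le_of_ne (hρ.eigenvalues_nonneg i) fun hp => hz (by rw [← hp, mul_zero])
      exact ⟨(intervalIntegrable_div_lineMap hp hq).const_mul _, by
        rw [intervalIntegral.integral_const_mul, integral_div_lineMap hp hq]⟩
  have hsum : ∀ j, IntervalIntegrable (fun s : ℝ =>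
      ∑ i, overlap hρ.isHermitian hσ.isHermitian j i * (hρ.isHermitian.eigenvalues i *
        (hρ.isHermitian.eigenvalues i - hσ.isHermitian.eigenvalues j) /
        ((1 - s) * hρ.isHermitian.eigenvalues i + s * hσ.isHermitian.eigenvalues j)))
      MeasureTheory.volume 0 1 := fun j => by
    simpa only [Finset.sum_fn] using
      IntervalIntegrable.sum Finset.univ (fun i _ => (key j i).1)
  unfold relEntropyIntegrand
  refine ⟨by simpa only [Finset.sum_fn] using
    IntervalIntegrable.sum Finset.univ (fun j _ => hsum j), ?_⟩
  rw [intervalIntegral.integral_finsetSum fun j _ => hsum j, relEntropy]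
  refine Finset.sum_congr rfl fun j _ => ?_
  rw [intervalIntegral.integral_finsetSum fun i _ => (key j i).1]
  exact Finset.sum_congr rfl fun i _ => (key j i).2

lemma sum_overlap_mul {ρ σ : Matrix n n ℂ} (hρ : ρ.IsHermitian)
    (hσ : σ.IsHermitian) (g : n → ℝ) :
    ∑ j, ∑ i, overlap hρ hσ j i * g i = ∑ i, g i := by
  rw [Finset.sum_comm]
  simp only [← Finset.sum_mul, sum_overlap, one_mul]

lemma relEntropyIntegrand_eq {ρ σ : Matrix n n ℂ} (hρ : ρ.PosSemidef) (hσ : σ.PosSemidef)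
    {s : ℝ} (hs0 : 0 < s) (hs1 : s < 1) :
    relEntropyIntegrand hρ.isHermitian hσ.isHermitian s =
      (variationalSup s hρ.isHermitian hσ.isHermitian - ρ.trace.re) / s := by
  have ht : ρ.trace.re = ∑ i, hρ.isHermitian.eigenvalues i := by
    rw [hρ.isHermitian.trace_eq_sum_eigenvalues]
    simp
  rw [ht, ← sum_overlap_mul hρ.isHermitian hσ.isHermitian, variationalSup,
    relEntropyIntegrand]
  simp only [← Finset.sum_sub_distrib, Finset.sum_div]
  refine Finset.sum_congr rfl fun j _ => Finset.sum_congr rfl fun i _ => ?_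
  have hp := hρ.eigenvalues_nonneg i
  have hq := hσ.eigenvalues_nonneg j
  rcases hp.eq_or_lt with hp | hp
  · rw [← hp]
    simp
  · have : 0 < 1 - s := by linarith
    have hc : 0 < (1 - s) * hρ.isHermitian.eigenvalues i + s * hσ.isHermitian.eigenvalues j := by
      positivity
    field_simp
    ring

/-- Monotonicity of the relative entropy under quantum channels. -/
theorem relEntropy_krausMap_le {K : ι → Matrix m n ℂ} (hK : ∑ j, (K j)ᴴ * K j = 1)
    {ρ σ : Matrix n n ℂ} (hρ : ρ.PosSemidef) (hσ : σ.PosSemidef)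
    (h : SupportedIn hρ.isHermitian hσ.isHermitian)
    (hE : SupportedIn (krausMap_posSemidef K hρ).isHermitian
      (krausMap_posSemidef K hσ).isHermitian) :
    relEntropy (krausMap_posSemidef K hρ).isHermitian (krausMap_posSemidef K hσ).isHermitian ≤
      relEntropy hρ.isHermitian hσ.isHermitian := by
  obtain ⟨hi, he⟩ := intervalIntegrable_and_integral_eq_relEntropy hρ hσ h
  obtain ⟨hi', he'⟩ := intervalIntegrable_and_integral_eq_relEntropy (krausMap_posSemidef K hρ)
    (krausMap_posSemidef K hσ) hE
  rw [← he, ← he']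
  refine intervalIntegral.integral_mono_on_of_le_Ioo zero_le_one hi' hi fun s hs => ?_
  rw [relEntropyIntegrand_eq hρ hσ hs.1 hs.2, relEntropyIntegrand_eq (krausMap_posSemidef K hρ)
    (krausMap_posSemidef K hσ) hs.1 hs.2, trace_krausMap hK]
  have := variationalSup_krausMap_le hK hρ hσ hs.1 hs.2
  have := hs.1
  gcongr

/-! ### Pinching -/

/-- The map setting to zero every entry whose indices carry different labels. -/
def pinch [DecidableEq κ] (f : n → κ) (ρ : Matrix n n ℂ) : Matrix n n ℂ :=
  Matrix.of fun p q => if f p = f q then ρ p q else 0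

section Pinching

variable [DecidableEq κ] (f : n → κ)

lemma commute_pinch_labelProj (ρ : Matrix n n ℂ) (k : κ) :
    Commute (pinch f ρ) (labelProj f k) := by
  rw [commute_iff_eq]
  ext p q
  simp only [labelProj, pinch, Matrix.mul_diagonal, Matrix.diagonal_mul, Matrix.of_apply]
  by_cases h : f p = f q <;> simp [h]

variable [Fintype κ]

lemma sum_conjTranspose_labelProj_mul :
    ∑ k, (labelProj f k)ᴴ * labelProj f k = 1 := by
  ext p q
  simp only [conjTranspose_labelProj]
  simp only [labelProj, Matrix.diagonal_mul_diagonal, Matrix.sum_apply,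
    Matrix.diagonal_apply, Matrix.one_apply]
  split_ifs <;> simp

lemma pinch_eq_krausMap (ρ : Matrix n n ℂ) : pinch f ρ = krausMap (labelProj f) ρ := by
  ext p q
  simp only [krausMap, conjTranspose_labelProj]
  simp only [labelProj, Matrix.sum_apply, Matrix.diagonal_mul, Matrix.mul_diagonal, pinch,
    Matrix.of_apply, ite_mul, one_mul, zero_mul, mul_ite, mul_one, mul_zero]
  simp [eq_comm]

lemma pinch_posSemidef {ρ : Matrix n n ℂ} (hρ : ρ.PosSemidef) : (pinch f ρ).PosSemidef := by
  rw [pinch_eq_krausMap]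
  exact krausMap_posSemidef _ hρ

lemma trace_mul_eq_trace_pinch_mul (ρ : Matrix n n ℂ) {Y : Matrix n n ℂ}
    (hY : ∀ k, Commute Y (labelProj f k)) : (ρ * Y).trace = (pinch f ρ * Y).trace := by
  rw [pinch_eq_krausMap, trace_krausMap_mul]
  congr 2
  have := sum_conjTranspose_labelProj_mul f
  simp only [conjTranspose_labelProj] at this
  simp only [krausMap, conjTranspose_labelProj, ← (hY _).eq, Matrix.mul_assoc]
  rw [← Matrix.mul_sum, this, Matrix.mul_one]

lemma sum_overlap_pinch {ρ : Matrix n n ℂ} (hρ : ρ.IsHermitian) (hσ : (pinch f ρ).IsHermitian)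
    (g : ℝ → ℝ) :
    ∑ j, ∑ i, overlap hρ hσ j i * hρ.eigenvalues i * g (hσ.eigenvalues j) =
      ∑ j, hσ.eigenvalues j * g (hσ.eigenvalues j) := by
  rw [← trace_mul_eigenMap, ← trace_mul_eigenMap_self, trace_mul_eq_trace_pinch_mul f ρ
    fun k => commute_eigenMap hσ g (commute_pinch_labelProj f ρ k)]

lemma supportedIn_pinch {ρ : Matrix n n ℂ} (hρ : ρ.PosSemidef) :
    SupportedIn hρ.isHermitian (pinch_posSemidef f hρ).isHermitian := by
  intro j i hj
  have hnn : ∀ j i, 0 ≤ overlap hρ.isHermitian (pinch_posSemidef f hρ).isHermitian j i *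
      hρ.isHermitian.eigenvalues i *
      (if (pinch_posSemidef f hρ).isHermitian.eigenvalues j = 0 then 1 else 0) := fun j i =>
    mul_nonneg (mul_nonneg (overlap_nonneg _ _ _ _) (hρ.eigenvalues_nonneg i))
      (by split_ifs <;> simp)
  have h := sum_overlap_pinch f hρ.isHermitian (pinch_posSemidef f hρ).isHermitian
    fun x => if x = 0 then 1 else 0
  have h0 : ∀ x : ℝ, x * (if x = 0 then 1 else 0) = 0 := fun x => by
    rw [mul_ite, mul_one, mul_zero, ite_eq_right_iff]
    exact id
  rw [Finset.sum_eq_zero (s := Finset.univ) fun j _ => h0 (Matrix.IsHermitian.eigenvalues _ j),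
    Finset.sum_eq_zero_iff_of_nonneg fun j _ => Finset.sum_nonneg fun i _ => hnn j i] at h
  have hji := (Finset.sum_eq_zero_iff_of_nonneg fun i _ => hnn j i).mp (h j (Finset.mem_univ j)) i
    (Finset.mem_univ i)
  simpa [hj] using hji

lemma relEntropy_pinch {ρ : Matrix n n ℂ} (hρ : ρ.PosSemidef) :
    relEntropy hρ.isHermitian (pinch_posSemidef f hρ).isHermitian = vN (pinch f ρ) - vN ρ := by
  have h := sum_overlap_pinch f hρ.isHermitian (pinch_posSemidef f hρ).isHermitian Real.log
  rw [relEntropy, vN_of_isHermitian hρ.isHermitian,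
    vN_of_isHermitian (pinch_posSemidef f hρ).isHermitian]
  simp only [mul_sub, Finset.sum_sub_distrib, ← mul_assoc, Real.negMulLog, neg_mul,
    Finset.sum_neg_distrib, h]
  simp only [mul_assoc]
  rw [sum_overlap_mul hρ.isHermitian (pinch_posSemidef f hρ).isHermitian
    fun i => hρ.isHermitian.eigenvalues i * Real.log (hρ.isHermitian.eigenvalues i)]
  ring

lemma pinch_krausMap {K : ι → Matrix n n ℂ} (hK : ∀ j k, Commute (labelProj f k) (K j))
    (ρ : Matrix n n ℂ) : pinch f (krausMap K ρ) = krausMap K (pinch f ρ) := by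
  have hK' : ∀ j k, (K j)ᴴ * labelProj f k = labelProj f k * (K j)ᴴ := fun j k => by
    have := congrArg Matrix.conjTranspose (hK j k).eq
    simpa only [Matrix.conjTranspose_mul, conjTranspose_labelProj] using this
  simp only [pinch_eq_krausMap, krausMap, Matrix.mul_sum, Matrix.sum_mul, conjTranspose_labelProj]
  rw [Finset.sum_comm]
  refine Finset.sum_congr rfl fun j _ => Finset.sum_congr rfl fun k _ => ?_
  simp only [Matrix.mul_assoc, hK']
  simp only [← Matrix.mul_assoc, (hK j k).eq]

/-- A channel commuting with the label projections does not increase the coherence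
`S(pinch f ρ) - S(ρ)`. -/
theorem vN_pinch_krausMap_sub_le {K : ι → Matrix n n ℂ} (hK : ∑ j, (K j)ᴴ * K j = 1)
    (hc : ∀ j k, Commute (labelProj f k) (K j)) {ρ : Matrix n n ℂ} (hρ : ρ.PosSemidef) :
    vN (pinch f (krausMap K ρ)) - vN (krausMap K ρ) ≤ vN (pinch f ρ) - vN ρ := by
  have hE := supportedIn_pinch f (krausMap_posSemidef K hρ)
  rw [← relEntropy_pinch f hρ, ← relEntropy_pinch f (krausMap_posSemidef K hρ)]
  have e := pinch_krausMap f hc ρ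
  have h := relEntropy_krausMap_le hK hρ (pinch_posSemidef f hρ) (supportedIn_pinch f hρ)
  simp only [← e] at h
  exact h hE

end Pinching

end RelativeEntropy

/-- Theorem 6: if `ρ_f` arises from `ρ_i` by sending subsystem `R` through an
incoherent quantum channel, then `C^{AR|B}(ρ_f) − C^{A|BR}(ρ_i) ≤ C^{R|AB}(ρ_f)`. -/
theorem coherence_entanglement_distribution_noisy
    {nA nB nR : Type*} [Fintype nA] [DecidableEq nA] [Nonempty nA]
    [Fintype nB] [DecidableEq nB] [Nonempty nB]
    [Fintype nR] [DecidableEq nR] [Nonempty nR]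
    {ι : Type*} [Fintype ι]
    (M : ι → Matrix nR nR ℂ) (hM : ∑ j, (M j)ᴴ * M j = 1)
    (hinc : ∀ j, ∀ d : Matrix nR nR ℂ, d.IsDiag → (M j * d * (M j)ᴴ).IsDiag)
    (ρi : Matrix (nA × nB × nR) (nA × nB × nR) ℂ) (hρi : ρi.PosSemidef)
    (htri : ρi.trace = 1) :
    let ρf : Matrix (nA × nB × nR) (nA × nB × nR) ℂ :=
      ∑ j, ((1 : Matrix nA nA ℂ) ⊗ₖ ((1 : Matrix nB nB ℂ) ⊗ₖ M j)) * ρi *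
        ((1 : Matrix nA nA ℂ) ⊗ₖ ((1 : Matrix nB nB ℂ) ⊗ₖ M j))ᴴ
    (vN (dephAR3 ρf) - vN ρf) - (vN (dephA3 ρi) - vN ρi) ≤ vN (dephR3 ρf) - vN ρf := by
  intro ρf
  set K : ι → Matrix (nA × nB × nR) (nA × nB × nR) ℂ :=
    fun j => (1 : Matrix nA nA ℂ) ⊗ₖ ((1 : Matrix nB nB ℂ) ⊗ₖ M j) with hKdef
  have hK : ∑ j, (K j)ᴴ * K j = 1 := by
    have hj : ∀ j, (K j)ᴴ * K j =
        (1 : Matrix nA nA ℂ) ⊗ₖ ((1 : Matrix nB nB ℂ) ⊗ₖ ((M j)ᴴ * M j)) := fun j => by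
      simp only [hKdef, Matrix.conjTranspose_kronecker, Matrix.conjTranspose_one,
        ← Matrix.mul_kronecker_mul, Matrix.one_mul]
    have hs : ∑ j, (K j)ᴴ * K j =
        (1 : Matrix nA nA ℂ) ⊗ₖ ((1 : Matrix nB nB ℂ) ⊗ₖ ∑ j, (M j)ᴴ * M j) := by
      simp only [hj]
      ext p q
      simp only [Matrix.sum_apply, Matrix.kroneckerMap_apply, Finset.mul_sum]
    rw [hs, hM, Matrix.one_kronecker_one, Matrix.one_kronecker_one]
  have hcK : ∀ j k, Commute (labelProj (Prod.fst : nA × nB × nR → nA) k) (K j) := by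
    intro j k
    rw [commute_iff_eq]
    ext p q
    simp only [hKdef, labelProj, Matrix.mul_diagonal, Matrix.diagonal_mul,
      Matrix.kroneckerMap_apply, Matrix.one_apply]
    by_cases h : p.1 = q.1
    · simp only [h, mul_comm]
    · simp [h]
  have hρf : ρf = krausMap K ρi := rfl
  have h1 := vN_pinch_krausMap_sub_le (Prod.fst : nA × nB × nR → nA) hK hcK hρi
  have h2 := vN_pinch_krausMap_sub_le (Prod.fst : nA × nB × nR → nA)
    (sum_conjTranspose_labelProj_mul fun p : nA × nB × nR => p.2.2)
    (fun j k => Matrix.commute_diagonal _ _) (krausMap_posSemidef K hρi)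
  rw [← hρf] at h1 h2
  rw [← pinch_eq_krausMap] at h2
  have eA : ∀ ρ : Matrix (nA × nB × nR) (nA × nB × nR) ℂ, dephA3 ρ = pinch Prod.fst ρ :=
    fun _ => rfl
  have eR : dephR3 ρf = pinch (fun p => p.2.2) ρf := rfl
  have eAR : dephAR3 ρf = pinch Prod.fst (pinch (fun p => p.2.2) ρf) := by
    ext p q
    simp only [dephAR3, pinch, Matrix.of_apply, ite_and]
  rw [eA, eR, eAR]
  linarith
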